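/- The Hanf number of the well-ordering-quantifier logic is at most that of the countable-set-quantifier logic: h(L^{wo}_{ω,ω}) ≤ h(L^c_{ω,ω}). -/

import Mathlib

open FirstOrder Cardinal

namespace Hanf

/-- Formulas of (extensions of) infinitary first-order logic over a vocabulary `L`:
first-order logic with equality, infinitary conjunctions, monadic second-order
(set) variables, binary relation variables, and the quantifiers
`wo` (well-ordering), `∃^c` (countable set), `aa` (stationary), `∃R` (second order),
and `Q^{cf}_{ℵ₀}` (countable cofinality). -/
inductive Fml (L : FirstOrder.Language.{0,0}) : Type 1
  | rel : {n : ℕ} → L.Relations n → (Fin n → L.Term ℕ) → Fml L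
  | eq : L.Term ℕ → L.Term ℕ → Fml L
  | mem : ℕ → L.Term ℕ → Fml L
  | rmem : ℕ → L.Term ℕ → L.Term ℕ → Fml L
  | not : Fml L → Fml L
  | conj : (ι : Type) → (ι → Fml L) → Fml L
  | all : ℕ → Fml L → Fml L
  | qWo : ℕ → ℕ → Fml L → Fml L
  | qC : ℕ → Fml L → Fml L
  | qAA : ℕ → Fml L → Fml L
  | qII : ℕ → Fml L → Fml L
  | qCf : ℕ → ℕ → Fml L → Fml L

variable {L : FirstOrder.Language.{0,0}}

/-- A family of countable subsets of `M` which is closed under unions of countable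
increasing chains and cofinal (under `⊆`) in the countable subsets of `M`. -/
def IsClubFam {M : Type} (C : Set (Set M)) : Prop :=
  (∀ S ∈ C, S.Countable) ∧
  (∀ f : ℕ → Set M, (∀ n, f n ∈ C) → Monotone f → (⋃ n, f n) ∈ C) ∧
  (∀ S : Set M, S.Countable → ∃ T ∈ C, S ⊆ T)

/-- The field of a binary relation. -/
def fieldOf {M : Type} (r : M → M → Prop) : Set M :=
  {a | (∃ b, r a b) ∨ ∃ b, r b a}

/-- `r` well-orders its field. -/
def WellOrdersField {M : Type} (r : M → M → Prop) : Prop :=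
  IsWellOrder (fieldOf r) (fun a b => r a.1 b.1)

/-- `r` is a linear order of its field, of cofinality `ℵ₀`:
it is irreflexive, transitive and trichotomous on its field, some countable
sequence is cofinal in it, and it has no maximal element. -/
def LinearOrdersFieldCofOmega {M : Type} (r : M → M → Prop) : Prop :=
  (∀ a ∈ fieldOf r, ¬ r a a) ∧
  (∀ a ∈ fieldOf r, ∀ b ∈ fieldOf r, ∀ c ∈ fieldOf r, r a b → r b c → r a c) ∧
  (∀ a ∈ fieldOf r, ∀ b ∈ fieldOf r, a ≠ b → r a b ∨ r b a) ∧
  (∃ c : ℕ → M, (∀ n, c n ∈ fieldOf r) ∧ ∀ a ∈ fieldOf r, ∃ n, a = c n ∨ r a (c n)) ∧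
  (∀ a ∈ fieldOf r, ∃ b ∈ fieldOf r, r a b)

/-- Satisfaction, relative to assignments of the first-order variables,
the monadic (set) variables and the binary relation variables. -/
def Eval {M : Type} [L.Structure M] :
    Fml L → (ℕ → M) → (ℕ → Set M) → (ℕ → M → M → Prop) → Prop
  | .rel R ts, va, _, _ => Language.Structure.RelMap R (fun i => (ts i).realize va)
  | .eq t₁ t₂, va, _, _ => t₁.realize va = t₂.realize va
  | .mem X t, va, vs, _ => t.realize va ∈ vs X
  | .rmem R t₁ t₂, va, _, vr => vr R (t₁.realize va) (t₂.realize va)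
  | .not φ, va, vs, vr => ¬ Eval φ va vs vr
  | .conj _ f, va, vs, vr => ∀ i, Eval (f i) va vs vr
  | .all x φ, va, vs, vr => ∀ a, Eval φ (Function.update va x a) vs vr
  | .qWo x y φ, va, vs, vr =>
      WellOrdersField (fun a b =>
        Eval φ (Function.update (Function.update va x a) y b) vs vr)
  | .qC X φ, va, vs, vr => ∃ S : Set M, S.Countable ∧ Eval φ va (Function.update vs X S) vr
  | .qAA X φ, va, vs, vr =>
      ∃ C : Set (Set M), IsClubFam C ∧ ∀ S ∈ C, Eval φ va (Function.update vs X S) vr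
  | .qII R φ, va, vs, vr => ∃ r : M → M → Prop, Eval φ va vs (Function.update vr R r)
  | .qCf x y φ, va, vs, vr =>
      LinearOrdersFieldCofOmega (fun a b =>
        Eval φ (Function.update (Function.update va x a) y b) vs vr)

/-- The variables of a term. -/
def tvars : L.Term ℕ → Set ℕ
  | .var i => {i}
  | .func _ ts => ⋃ i, tvars (ts i)

/-- Free first-order variables. -/
def fv : Fml L → Set ℕ
  | .rel _ ts => ⋃ i, tvars (ts i)
  | .eq t₁ t₂ => tvars t₁ ∪ tvars t₂
  | .mem _ t => tvars t
  | .rmem _ t₁ t₂ => tvars t₁ ∪ tvars t₂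
  | .not φ => fv φ
  | .conj _ f => ⋃ i, fv (f i)
  | .all x φ => fv φ \ {x}
  | .qWo x y φ => fv φ \ {x, y}
  | .qC _ φ => fv φ
  | .qAA _ φ => fv φ
  | .qII _ φ => fv φ
  | .qCf x y φ => fv φ \ {x, y}

/-- Free monadic (set) variables. -/
def sv : Fml L → Set ℕ
  | .rel _ _ => ∅
  | .eq _ _ => ∅
  | .mem X _ => {X}
  | .rmem _ _ _ => ∅
  | .not φ => sv φ
  | .conj _ f => ⋃ i, sv (f i)
  | .all _ φ => sv φ
  | .qWo _ _ φ => sv φ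
  | .qC X φ => sv φ \ {X}
  | .qAA X φ => sv φ \ {X}
  | .qII _ φ => sv φ
  | .qCf _ _ φ => sv φ

/-- Free binary relation variables. -/
def rv : Fml L → Set ℕ
  | .rel _ _ => ∅
  | .eq _ _ => ∅
  | .mem _ _ => ∅
  | .rmem R _ _ => {R}
  | .not φ => rv φ
  | .conj _ f => ⋃ i, rv (f i)
  | .all _ φ => rv φ
  | .qWo _ _ φ => rv φ
  | .qC _ φ => rv φ
  | .qAA _ φ => rv φ
  | .qII R φ => rv φ \ {R}
  | .qCf _ _ φ => rv φ

/-- A sentence: no free variables of any kind. -/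
def IsSentence (φ : Fml L) : Prop := fv φ = ∅ ∧ sv φ = ∅ ∧ rv φ = ∅

/-- Which extra quantifiers a logic allows, and the bound on the size
of its conjunctions (`conjBound = ℵ₀` gives finitary logic). -/
structure Allowed where
  wo : Prop
  c : Prop
  aa : Prop
  ii : Prop
  cf : Prop
  conjBound : Cardinal.{0}

/-- The formula lies in the logic described by `A`. -/
def Ok (A : Allowed) : Fml L → Prop
  | .rel _ _ => True
  | .eq _ _ => True
  | .mem _ _ => True
  | .rmem _ _ _ => True
  | .not φ => Ok A φ
  | .conj ι f => #ι < A.conjBound ∧ ∀ i, Ok A (f i)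
  | .all _ φ => Ok A φ
  | .qWo _ _ φ => A.wo ∧ Ok A φ
  | .qC _ φ => A.c ∧ Ok A φ
  | .qAA _ φ => A.aa ∧ Ok A φ
  | .qII _ φ => A.ii ∧ Ok A φ
  | .qCf _ _ φ => A.cf ∧ Ok A φ

/-- `M ⊨ φ` (for sentences this does not depend on the assignments). -/
def Sat (M : Type) [L.Structure M] (φ : Fml L) : Prop :=
  ∀ (va : ℕ → M) (vs : ℕ → Set M) (vr : ℕ → M → M → Prop), Eval φ va vs vr

/-- `h(φ) < ∞`: `φ` has no models of arbitrarily large cardinality. -/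
def BddSpec (φ : Fml L) : Prop :=
  ∃ κ : Cardinal, ∀ (M : Type) (S : L.Structure M), @Sat L M S φ → #M < κ

/-- The Hanf value `h(φ) = sup {|M|⁺ : M ⊨ φ}`. -/
noncomputable def hanfVal (φ : Fml L) : Cardinal :=
  sSup {c | ∃ (M : Type) (S : L.Structure M), @Sat L M S φ ∧ c = Order.succ #M}

/-- The Hanf number of the logic `A`: the supremum of `h(φ)` over all
sentences `φ` of the logic (in any vocabulary) with `h(φ) < ∞`. -/
noncomputable def hanfNum (A : Allowed) : Cardinal :=
  sSup {c | ∃ (L : FirstOrder.Language.{0,0}) (φ : Fml L),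
    IsSentence φ ∧ Ok A φ ∧ BddSpec φ ∧ c = hanfVal φ}

/-- The Hanf number of the logic `A` computed over vocabularies of cardinality `≤ χ`. -/
noncomputable def hanfNumVocab (A : Allowed) (χ : Cardinal) : Cardinal :=
  sSup {c | ∃ (L : FirstOrder.Language.{0,0}), L.card ≤ χ ∧ ∃ φ : Fml L,
    IsSentence φ ∧ Ok A φ ∧ BddSpec φ ∧ c = hanfVal φ}

/-- `L^{wo}_{ω,ω}`. -/
def Lwo : Allowed := ⟨True, False, False, False, False, ℵ₀⟩
/-- `L^c_{ω,ω}`. -/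
def Lc : Allowed := ⟨False, True, False, False, False, ℵ₀⟩
/-- `L^{aa}_{ω,ω}`. -/
def Laa : Allowed := ⟨False, False, True, False, False, ℵ₀⟩
/-- `L^{II}_{ω,ω}`. -/
def LII : Allowed := ⟨False, False, False, True, False, ℵ₀⟩
/-- `L_{ω,ω}(Q^{cf}_{ℵ₀})`. -/
def Lcf : Allowed := ⟨False, False, False, False, True, ℵ₀⟩
/-- `L^{wo}_{κ,ω}`: conjunctions of `< κ` formulas. -/
def LwoInf (κ : Cardinal) : Allowed := ⟨True, False, False, False, False, κ⟩
/-- `L^c_{κ,ω}`. -/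
def LcInf (κ : Cardinal) : Allowed := ⟨False, True, False, False, False, κ⟩
/-- `L^{II}_{κ,ω}`. -/
def LIIInf (κ : Cardinal) : Allowed := ⟨False, False, False, True, False, κ⟩


/-! ### Part 1: translation of the well-ordering quantifier -/

section Translation


/-- Binary conjunction. -/
def fAnd (φ ψ : Fml L) : Fml L := .conj Bool (fun b => cond b φ ψ)
/-- Implication. -/
def fImp (φ ψ : Fml L) : Fml L := .not (fAnd φ (.not ψ))
/-- Disjunction. -/
def fOr (φ ψ : Fml L) : Fml L := fImp (.not φ) ψ
/-- Existential quantifier. -/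
def fEx (x : ℕ) (φ : Fml L) : Fml L := .not (.all x (.not φ))
/-- Equality of variables. -/
def fEq (x y : ℕ) : Fml L := .eq (.var x) (.var y)
/-- Membership of a variable in set variable `0`. -/
def fMem (x : ℕ) : Fml L := .mem 0 (.var x)

section
variable {M : Type} [L.Structure M] (va : ℕ → M) (vs : ℕ → Set M) (vr : ℕ → M → M → Prop)

theorem eval_and (φ ψ : Fml L) :
    Eval (fAnd φ ψ) va vs vr ↔ Eval φ va vs vr ∧ Eval ψ va vs vr := by
  simp [fAnd, Eval, and_comm]

theorem eval_not (φ : Fml L) : Eval (.not φ) va vs vr ↔ ¬ Eval φ va vs vr := by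
  simp [Eval]

theorem eval_all (x : ℕ) (φ : Fml L) :
    Eval (.all x φ) va vs vr ↔ ∀ a, Eval φ (Function.update va x a) vs vr := by
  simp [Eval]

theorem eval_imp (φ ψ : Fml L) :
    Eval (fImp φ ψ) va vs vr ↔ (Eval φ va vs vr → Eval ψ va vs vr) := by
  simp [fImp, eval_not, eval_and]

theorem eval_or (φ ψ : Fml L) :
    Eval (fOr φ ψ) va vs vr ↔ (Eval φ va vs vr ∨ Eval ψ va vs vr) := by
  simp only [fOr, eval_imp, eval_not]; tauto

theorem eval_ex (x : ℕ) (φ : Fml L) :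
    Eval (fEx x φ) va vs vr ↔ ∃ a, Eval φ (Function.update va x a) vs vr := by
  simp [fEx, Eval]

theorem eval_eq (x y : ℕ) : Eval (fEq x y : Fml L) va vs vr ↔ va x = va y := by
  simp [fEq, Eval]

theorem eval_mem (x : ℕ) : Eval (fMem x : Fml L) va vs vr ↔ va x ∈ vs 0 := by
  simp [fMem, Eval]

theorem eval_qC (X : ℕ) (φ : Fml L) : Eval (.qC X φ) va vs vr ↔
    ∃ S : Set M, S.Countable ∧ Eval φ va (Function.update vs X S) vr := by
  simp [Eval]

end

/-- `φ` at the pair of (small) variables `a`, `b`, substituted for `x`, `y`. -/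
def fRel (x y : ℕ) (φ : Fml L) (a b : ℕ) : Fml L :=
  .all x (fImp (fEq x a) (.all y (fImp (fEq y b) φ)))

/-- Membership in the field. -/
def fField (x y : ℕ) (φ : Fml L) (a : ℕ) : Fml L :=
  fEx 2 (fOr (fRel x y φ a 2) (fRel x y φ 2 a))

/-- The well-ordering quantifier written with the countable set quantifier. -/
def fWo (x y : ℕ) (φ : Fml L) : Fml L :=
  fAnd (.all 0 (.all 1 (fImp (fAnd (fField x y φ 0) (fField x y φ 1))
      (fOr (fRel x y φ 0 1) (fOr (fEq 0 1) (fRel x y φ 1 0))))))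
    (fAnd (.all 0 (.all 1 (.all 2 (fImp (fRel x y φ 0 1) (fImp (fRel x y φ 1 2)
      (fRel x y φ 0 2))))))
    (.not (.qC 0 (fAnd (fEx 0 (fMem 0))
      (.all 0 (fImp (fMem 0) (fEx 1 (fAnd (fMem 1) (fRel x y φ 1 0)))))))))

/-- The translation. First-order variables are shifted by three. -/
def tr : Fml L → Fml L
  | .rel R ts => .rel R (fun i => (ts i).relabel (· + 3))
  | .eq t₁ t₂ => .eq (t₁.relabel (· + 3)) (t₂.relabel (· + 3))
  | .mem X t => .mem X (t.relabel (· + 3))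
  | .rmem R t₁ t₂ => .rmem R (t₁.relabel (· + 3)) (t₂.relabel (· + 3))
  | .not φ => .not (tr φ)
  | .conj ι f => .conj ι (fun i => tr (f i))
  | .all x φ => .all (x + 3) (tr φ)
  | .qWo x y φ => fWo (x + 3) (y + 3) (tr φ)
  | .qC X φ => .qC X (tr φ)
  | .qAA X φ => .qAA X (tr φ)
  | .qII R φ => .qII R (tr φ)
  | .qCf x y φ => .qCf (x + 3) (y + 3) (tr φ)

theorem wellOrdersField_iff {M : Type} (r : M → M → Prop) :
    WellOrdersField r ↔
      (∀ a b, (∃ c, r a c ∨ r c a) ∧ (∃ c, r b c ∨ r c b) → r a b ∨ a = b ∨ r b a) ∧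
      (∀ a b c, r a b → r b c → r a c) ∧
      ¬ ∃ S : Set M, S.Countable ∧ (∃ a, a ∈ S) ∧ ∀ a, a ∈ S → ∃ b, b ∈ S ∧ r b a := by
  have hf : ∀ a, a ∈ fieldOf r ↔ ∃ c, r a c ∨ r c a := by
    intro a; simp [fieldOf, exists_or]
  unfold WellOrdersField
  constructor
  · intro h
    refine ⟨?_, ?_, ?_⟩
    · rintro a b ⟨ha, hb⟩
      have := trichotomous_of (fun a b : fieldOf r => r a.1 b.1)
        ⟨a, (hf a).2 ha⟩ ⟨b, (hf b).2 hb⟩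
      simpa using this
    · intro a b c hab hbc
      exact _root_.trans_of (fun a b : fieldOf r => r a.1 b.1)
        (a := ⟨a, (hf a).2 ⟨b, .inl hab⟩⟩) (b := ⟨b, (hf b).2 ⟨c, .inl hbc⟩⟩)
        (c := ⟨c, (hf c).2 ⟨b, .inr hbc⟩⟩) hab hbc
    · rintro ⟨S, -, ⟨a, ha⟩, hS⟩
      have hS' : ∀ a ∈ S, a ∈ fieldOf r := fun a ha => by
        obtain ⟨b, -, hb⟩ := hS a ha
        exact (hf a).2 ⟨b, .inr hb⟩
      obtain ⟨m, hm, hmin⟩ := h.wf.has_min {a : fieldOf r | a.1 ∈ S} ⟨⟨a, hS' a ha⟩, ha⟩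
      obtain ⟨b, hb, hbm⟩ := hS m.1 hm
      exact hmin ⟨b, hS' b hb⟩ hb hbm
  · rintro ⟨h1, h2, h3⟩
    have wf : WellFounded (fun a b : fieldOf r => r a.1 b.1) := by
      rw [wellFounded_iff_isEmpty_descending_chain]
      refine ⟨fun ⟨f, hfd⟩ => h3 ⟨Set.range (fun n => (f n).1), Set.countable_range _,
        ⟨_, ⟨0, rfl⟩⟩, ?_⟩⟩
      rintro _ ⟨n, rfl⟩
      exact ⟨_, ⟨n + 1, rfl⟩, hfd n⟩
    have tri : ∀ a b : fieldOf r, r a.1 b.1 ∨ a = b ∨ r b.1 a.1 := by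
      intro a b
      simpa [Subtype.ext_iff] using h1 a.1 b.1 ⟨(hf _).1 a.2, (hf _).1 b.2⟩
    have htri : Std.Trichotomous (fun a b : fieldOf r => r a.1 b.1) :=
      ⟨fun a b hab hba => by have := tri a b; tauto⟩
    have htr : IsTrans (fieldOf r) (fun a b => r a.1 b.1) :=
      ⟨fun a b c => h2 a.1 b.1 c.1⟩
    exact { trichotomous := htri.trichotomous, wf := wf }

theorem shift_small {M : Type} (va : ℕ → M) (k : ℕ) (hk : k < 3) (a : M) :
    (fun n => Function.update va k a (n + 3)) = fun n => va (n + 3) := by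
  funext n
  exact Function.update_of_ne (by omega) _ _

theorem shift_big {M : Type} (va : ℕ → M) (k : ℕ) (a : M) :
    (fun n => Function.update va (k + 3) a (n + 3)) =
      Function.update (fun n => va (n + 3)) k a := by
  funext n
  by_cases h : n = k
  · subst h; simp
  · rw [Function.update_of_ne h, Function.update_of_ne (by omega)]

theorem eval_rel {M : Type} [L.Structure M] (x y : ℕ) (φ : Fml L) (va : ℕ → M)
    (vs : ℕ → Set M) (vr : ℕ → M → M → Prop) (a b : ℕ) (ha : a < 3) (hb : b < 3) :
    Eval (fRel (x + 3) (y + 3) φ a b) va vs vr ↔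
      Eval φ (Function.update (Function.update va (x + 3) (va a)) (y + 3) (va b)) vs vr := by
  have h1 : a ≠ x + 3 := by omega
  have h2 : b ≠ x + 3 := by omega
  have h3 : b ≠ y + 3 := by omega
  simp [fRel, eval_all, eval_imp, eval_eq, Function.update_of_ne, h1, h2, h3]

theorem eval_tr {M : Type} [L.Structure M] (φ : Fml L) (hok : Ok Lwo φ) (hs : sv φ = ∅)
    (va : ℕ → M) (vs vs' : ℕ → Set M) (vr : ℕ → M → M → Prop) :
    Eval (tr φ) va vs vr ↔ Eval φ (fun n => va (n + 3)) vs' vr := by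
  induction φ generalizing va vs vs' vr with
  | rel R ts => simp [tr, Eval, Function.comp_def]
  | eq t₁ t₂ => simp [tr, Eval, Function.comp_def]
  | mem X t => simp [sv] at hs
  | rmem R t₁ t₂ => simp [tr, Eval, Function.comp_def]
  | not φ ih => 
    simp only [tr, eval_not]
    rw [ih hok hs va vs vs' vr]
  | conj ι f ih =>
    simp only [tr, Eval]
    simp only [sv, Set.iUnion_eq_empty] at hs
    exact forall_congr' fun i => ih i (hok.2 i) (hs i) va vs vs' vr
  | all x φ ih =>
    simp only [tr, eval_all]
    refine forall_congr' fun a => ?_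
    rw [ih hok hs _ vs vs' vr, shift_big]
  | qWo x y φ ih =>
    have key : ∀ (va' : ℕ → M) (vs'' : ℕ → Set M) (a b : ℕ), a < 3 → b < 3 →
        (Eval (fRel (x + 3) (y + 3) (tr φ) a b) va' vs'' vr ↔
        Eval φ (Function.update (Function.update (fun n => va' (n + 3)) x (va' a)) y (va' b))
          vs' vr) := by
      intro va' vs'' a b ha hb
      rw [eval_rel _ _ _ _ _ _ _ _ ha hb, ih hok.2 hs _ vs'' vs' vr, shift_big, shift_big]
    show Eval (fWo (x + 3) (y + 3) (tr φ)) va vs vr ↔ WellOrdersField _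
    rw [wellOrdersField_iff]
    simp only [fWo, fField, eval_and, eval_all, eval_imp, eval_or, eval_ex, eval_not, eval_qC,
      eval_eq, eval_mem, key, shift_small, Nat.ofNat_pos, Nat.one_lt_ofNat, Nat.lt_add_one]
    simp
  | qC X φ ih => exact absurd hok.1 (by simp [Lwo])
  | qAA X φ ih => exact absurd hok.1 (by simp [Lwo])
  | qII R φ ih => exact absurd hok.1 (by simp [Lwo])
  | qCf x y φ ih => exact absurd hok.1 (by simp [Lwo])

theorem ok_tr (φ : Fml L) (hok : Ok Lwo φ) : Ok Lc (tr φ) := by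
  induction φ with
  | rel R ts => trivial
  | eq t₁ t₂ => trivial
  | mem X t => trivial
  | rmem R t₁ t₂ => trivial
  | not φ ih => exact ih hok
  | conj ι f ih => exact ⟨hok.1, fun i => ih i (hok.2 i)⟩
  | all x φ ih => exact ih hok
  | qWo x y φ ih =>
    have h := ih hok.2
    have hb : Lc.conjBound = ℵ₀ := rfl
    have hc : Lc.c := trivial
    simp [tr, fWo, fField, fRel, fAnd, fOr, fImp, fEx, fEq, fMem, Ok, h, hb, hc]
  | qC X φ ih => exact absurd hok.1 (by simp [Lwo])
  | qAA X φ ih => exact absurd hok.1 (by simp [Lwo])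
  | qII R φ ih => exact absurd hok.1 (by simp [Lwo])
  | qCf x y φ ih => exact absurd hok.1 (by simp [Lwo])

theorem tvars_relabel (t : L.Term ℕ) (g : ℕ → ℕ) : tvars (t.relabel g) = g '' tvars t := by
  induction t with
  | var i => simp [tvars, Language.Term.relabel]
  | func f ts ih => simp [tvars, Language.Term.relabel, ih, Set.image_iUnion]

theorem fv_and (φ ψ : Fml L) : fv (fAnd φ ψ) = fv φ ∪ fv ψ := by
  ext; simp [fAnd, fv, or_comm]
theorem fv_imp (φ ψ : Fml L) : fv (fImp φ ψ) = fv φ ∪ fv ψ := by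
  simp [fImp, fv, fv_and]
theorem fv_or (φ ψ : Fml L) : fv (fOr φ ψ) = fv φ ∪ fv ψ := by
  simp [fOr, fv, fv_imp]
theorem sv_and (φ ψ : Fml L) : sv (fAnd φ ψ) = sv φ ∪ sv ψ := by
  ext; simp [fAnd, sv, or_comm]
theorem sv_imp (φ ψ : Fml L) : sv (fImp φ ψ) = sv φ ∪ sv ψ := by
  simp [fImp, sv, sv_and]
theorem sv_or (φ ψ : Fml L) : sv (fOr φ ψ) = sv φ ∪ sv ψ := by
  simp [fOr, sv, sv_imp]
theorem rv_and (φ ψ : Fml L) : rv (fAnd φ ψ) = rv φ ∪ rv ψ := by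
  ext; simp [fAnd, rv, or_comm]
theorem rv_imp (φ ψ : Fml L) : rv (fImp φ ψ) = rv φ ∪ rv ψ := by
  simp [fImp, rv, rv_and]
theorem rv_or (φ ψ : Fml L) : rv (fOr φ ψ) = rv φ ∪ rv ψ := by
  simp [fOr, rv, rv_imp]

theorem fv_rel (x y : ℕ) (φ : Fml L) (a b : ℕ) :
    fv (fRel x y φ a b) ⊆ (fv φ \ {x, y}) ∪ {a, b} := by
  intro z
  simp only [fRel, fv, fv_imp, fEq, tvars, Set.mem_sdiff, Set.mem_union, Set.mem_singleton_iff,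
    Set.mem_insert_iff]
  tauto

theorem fv_wo (x y : ℕ) (φ : Fml L) : fv (fWo x y φ) ⊆ fv φ \ {x, y} := by
  intro z hz
  by_contra hn
  have H : ∀ a b, z ∈ fv (fRel x y φ a b) → z = a ∨ z = b := by
    intro a b h
    rcases fv_rel x y φ a b h with h | h
    · exact absurd h hn
    · simpa using h
  simp only [fWo, fField, fEx, fEq, fMem, fv, fv_and, fv_imp, fv_or, tvars, Set.mem_sdiff,
    Set.mem_union, Set.mem_singleton_iff] at hz
  clear hn
  grind

theorem fv_tr (φ : Fml L) (hok : Ok Lwo φ) : fv (tr φ) ⊆ (· + 3) '' fv φ := by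
  induction φ with
  | rel R ts => simp [tr, fv, tvars_relabel, Set.image_iUnion]
  | eq t₁ t₂ => simp [tr, fv, tvars_relabel, Set.image_union]
  | mem X t => simp [tr, fv, tvars_relabel]
  | rmem R t₁ t₂ => simp [tr, fv, tvars_relabel, Set.image_union]
  | not φ ih => exact ih hok
  | conj ι f ih =>
    simp only [tr, fv, Set.image_iUnion]
    exact Set.iUnion_mono fun i => ih i (hok.2 i)
  | all x φ ih =>
    rintro z ⟨hz, hzx⟩
    obtain ⟨w, hw, rfl⟩ := ih hok hz
    exact ⟨w, ⟨hw, by simpa using hzx⟩, rfl⟩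
  | qWo x y φ ih =>
    intro z hz
    obtain ⟨hz, hzx⟩ := fv_wo _ _ _ hz
    obtain ⟨w, hw, rfl⟩ := ih hok.2 hz
    exact ⟨w, ⟨hw, by simpa using hzx⟩, rfl⟩
  | qC X φ ih => exact absurd hok.1 (by simp [Lwo])
  | qAA X φ ih => exact absurd hok.1 (by simp [Lwo])
  | qII R φ ih => exact absurd hok.1 (by simp [Lwo])
  | qCf x y φ ih => exact absurd hok.1 (by simp [Lwo])

theorem sv_tr (φ : Fml L) (hok : Ok Lwo φ) (h : sv φ = ∅) : sv (tr φ) = ∅ := by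
  induction φ with
  | rel R ts => rfl
  | eq t₁ t₂ => rfl
  | mem X t => simp [sv] at h
  | rmem R t₁ t₂ => rfl
  | not φ ih => exact ih hok h
  | conj ι f ih =>
    simp only [sv, tr, Set.iUnion_eq_empty] at h ⊢
    exact fun i => ih i (hok.2 i) (h i)
  | all x φ ih => exact ih hok h
  | qWo x y φ ih =>
    have h' := ih hok.2 h
    simp [tr, fWo, fField, fRel, fEx, fEq, fMem, sv, sv_and, sv_or, sv_imp, h']
  | qC X φ ih => exact absurd hok.1 (by simp [Lwo])
  | qAA X φ ih => exact absurd hok.1 (by simp [Lwo])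
  | qII R φ ih => exact absurd hok.1 (by simp [Lwo])
  | qCf x y φ ih => exact absurd hok.1 (by simp [Lwo])

theorem rv_tr (φ : Fml L) (hok : Ok Lwo φ) (h : rv φ = ∅) : rv (tr φ) = ∅ := by
  induction φ with
  | rel R ts => rfl
  | eq t₁ t₂ => rfl
  | mem X t => rfl
  | rmem R t₁ t₂ => simp [rv] at h
  | not φ ih => exact ih hok h
  | conj ι f ih =>
    simp only [rv, tr, Set.iUnion_eq_empty] at h ⊢
    exact fun i => ih i (hok.2 i) (h i)
  | all x φ ih => exact ih hok h
  | qWo x y φ ih =>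
    have h' := ih hok.2 h
    simp [tr, fWo, fField, fRel, fEx, fEq, fMem, rv, rv_and, rv_or, rv_imp, h']
  | qC X φ ih => exact absurd hok.1 (by simp [Lwo])
  | qAA X φ ih => exact absurd hok.1 (by simp [Lwo])
  | qII R φ ih => exact absurd hok.1 (by simp [Lwo])
  | qCf x y φ ih => exact absurd hok.1 (by simp [Lwo])

theorem sat_tr {M : Type} [L.Structure M] (φ : Fml L) (hok : Ok Lwo φ) (hs : sv φ = ∅) :
    Sat M (tr φ) ↔ Sat M φ := by
  constructor
  · intro h va vs vr
    have := (eval_tr φ hok hs (fun n => va (n - 3)) vs vs vr).1 (h _ _ _)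
    simpa using this
  · intro h va vs vr
    exact (eval_tr φ hok hs va vs vs vr).2 (h _ _ _)

end Translation

/-! ### Part 2: the set of Hanf values of `L^c` is bounded -/

section Bounded

/-- A universal countable vocabulary. -/
def U : FirstOrder.Language.{0,0} := ⟨fun _ => ℕ, fun _ => ℕ⟩

/-- Codes for formulas of `L^c` in the universal vocabulary; a small type. -/
inductive Code : Type
  | rel : (n : ℕ) → ℕ → (Fin n → U.Term ℕ) → Code
  | eq : U.Term ℕ → U.Term ℕ → Code
  | mem : ℕ → U.Term ℕ → Code
  | rmem : ℕ → U.Term ℕ → U.Term ℕ → Code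
  | not : Code → Code
  | conj : (n : ℕ) → (Fin n → Code) → Code
  | all : ℕ → Code → Code
  | qC : ℕ → Code → Code

/-- The formula coded. -/
def Code.toFml : Code → Fml U
  | .rel _ k ts => .rel (L := U) k ts
  | .eq t₁ t₂ => .eq t₁ t₂
  | .mem X t => .mem X t
  | .rmem R t₁ t₂ => .rmem R t₁ t₂
  | .not c => .not c.toFml
  | .conj n f => .conj (Fin n) (fun i => (f i).toFml)
  | .all x c => .all x c.toFml
  | .qC X c => .qC X c.toFml


/-- Function symbols of a term. -/
def tF : L.Term ℕ → Set (Σ n, L.Functions n)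
  | .var _ => ∅
  | .func f ts => {⟨_, f⟩} ∪ ⋃ i, tF (ts i)

/-- Function symbols of a formula. -/
def uF : Fml L → Set (Σ n, L.Functions n)
  | .rel _ ts => ⋃ i, tF (ts i)
  | .eq t₁ t₂ => tF t₁ ∪ tF t₂
  | .mem _ t => tF t
  | .rmem _ t₁ t₂ => tF t₁ ∪ tF t₂
  | .not φ => uF φ
  | .conj _ f => ⋃ i, uF (f i)
  | .all _ φ => uF φ
  | .qWo _ _ φ => uF φ
  | .qC _ φ => uF φ
  | .qAA _ φ => uF φ
  | .qII _ φ => uF φ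
  | .qCf _ _ φ => uF φ

/-- Relation symbols of a formula. -/
def uR : Fml L → Set (Σ n, L.Relations n)
  | .rel R _ => {⟨_, R⟩}
  | .eq _ _ => ∅
  | .mem _ _ => ∅
  | .rmem _ _ _ => ∅
  | .not φ => uR φ
  | .conj _ f => ⋃ i, uR (f i)
  | .all _ φ => uR φ
  | .qWo _ _ φ => uR φ
  | .qC _ φ => uR φ
  | .qAA _ φ => uR φ
  | .qII _ φ => uR φ
  | .qCf _ _ φ => uR φ

theorem tF_countable (t : L.Term ℕ) : (tF t).Countable := by
  induction t with
  | var i => exact Set.countable_empty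
  | func f ts ih => exact (Set.countable_singleton _).union (Set.countable_iUnion ih)

theorem uF_countable (φ : Fml L) (hok : Ok Lc φ) : (uF φ).Countable := by
  induction φ with
  | rel R ts => exact Set.countable_iUnion fun i => tF_countable _
  | eq t₁ t₂ => exact (tF_countable _).union (tF_countable _)
  | mem X t => exact tF_countable _
  | rmem R t₁ t₂ => exact (tF_countable _).union (tF_countable _)
  | not φ ih => exact ih hok
  | conj ι f ih =>
    have : Finite ι := Cardinal.lt_aleph0_iff_finite.1 hok.1
    exact Set.countable_iUnion fun i => ih i (hok.2 i)
  | all x φ ih => exact ih hok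
  | qWo x y φ ih => exact ih hok.2
  | qC X φ ih => exact ih hok.2
  | qAA X φ ih => exact ih hok.2
  | qII R φ ih => exact ih hok.2
  | qCf x y φ ih => exact ih hok.2

theorem uR_countable (φ : Fml L) (hok : Ok Lc φ) : (uR φ).Countable := by
  induction φ with
  | rel R ts => exact Set.countable_singleton _
  | eq t₁ t₂ => exact Set.countable_empty
  | mem X t => exact Set.countable_empty
  | rmem R t₁ t₂ => exact Set.countable_empty
  | not φ ih => exact ih hok
  | conj ι f ih =>
    have : Finite ι := Cardinal.lt_aleph0_iff_finite.1 hok.1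
    exact Set.countable_iUnion fun i => ih i (hok.2 i)
  | all x φ ih => exact ih hok
  | qWo x y φ ih => exact ih hok.2
  | qC X φ ih => exact ih hok.2
  | qAA X φ ih => exact ih hok.2
  | qII R φ ih => exact ih hok.2
  | qCf x y φ ih => exact ih hok.2

/-- The `L`-structure and the `U`-structure agree on the function symbols in `B`. -/
def AgreeF {M : Type} (SL : L.Structure M) (SU : U.Structure M)
    (γ : (Σ n, L.Functions n) → ℕ) (B : Set (Σ n, L.Functions n)) : Prop :=
  ∀ (n : ℕ) (f : L.Functions n), (⟨n, f⟩ : Σ n, L.Functions n) ∈ B → ∀ xs : Fin n → M,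
    SU.funMap (γ ⟨n, f⟩ : ℕ) xs = SL.funMap f xs

/-- The `L`-structure and the `U`-structure agree on the relation symbols in `A`. -/
def AgreeR {M : Type} (SL : L.Structure M) (SU : U.Structure M)
    (ρ : (Σ n, L.Relations n) → ℕ) (A : Set (Σ n, L.Relations n)) : Prop :=
  ∀ (n : ℕ) (f : L.Relations n), (⟨n, f⟩ : Σ n, L.Relations n) ∈ A → ∀ xs : Fin n → M,
    (SU.RelMap (ρ ⟨n, f⟩ : ℕ) xs ↔ SL.RelMap f xs)

/-- Coded term. -/
def tcode (γ : (Σ n, L.Functions n) → ℕ) : L.Term ℕ → U.Term ℕ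
  | .var i => .var i
  | .func f ts => .func (L := U) (γ ⟨_, f⟩ : ℕ) (fun i => tcode γ (ts i))

theorem AgreeF.mono {M : Type} {SL : L.Structure M} {SU : U.Structure M}
    {γ : (Σ n, L.Functions n) → ℕ} {B B' : Set (Σ n, L.Functions n)}
    (h : AgreeF SL SU γ B) (hB : B' ⊆ B) : AgreeF SL SU γ B' :=
  fun n f hf => h n f (hB hf)

theorem AgreeR.mono {M : Type} {SL : L.Structure M} {SU : U.Structure M}
    {γ : (Σ n, L.Relations n) → ℕ} {B B' : Set (Σ n, L.Relations n)}
    (h : AgreeR SL SU γ B) (hB : B' ⊆ B) : AgreeR SL SU γ B' :=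
  fun n f hf => h n f (hB hf)

theorem realize_tcode {M : Type} [SL : L.Structure M] [SU : U.Structure M]
    {γ : (Σ n, L.Functions n) → ℕ} (t : L.Term ℕ) (h : AgreeF SL SU γ (tF t)) (va : ℕ → M) :
    (tcode γ t).realize va = t.realize va := by
  induction t with
  | var i => rfl
  | func f ts ih =>
    simp only [tcode, Language.Term.realize]
    have h1 : (fun i => (tcode γ (ts i)).realize va) = fun i => (ts i).realize va := by
      funext i
      exact ih i (h.mono (Set.subset_union_of_subset_right
        (Set.subset_iUnion (fun i => tF (ts i)) i) _))
    rw [h1]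
    exact h _ f (Or.inl rfl) _

theorem exists_code (ρ : (Σ n, L.Relations n) → ℕ) (γ : (Σ n, L.Functions n) → ℕ)
    (φ : Fml L) (hok : Ok Lc φ) :
    ∃ c : Code, ∀ (M : Type) (SL : L.Structure M) (SU : U.Structure M),
      AgreeR SL SU ρ (uR φ) → AgreeF SL SU γ (uF φ) →
      ∀ (va : ℕ → M) (vs : ℕ → Set M) (vr : ℕ → M → M → Prop),
        (Eval c.toFml va vs vr ↔ Eval φ va vs vr) := by
  induction φ with
  | @rel n R ts =>
    refine ⟨.rel n (ρ ⟨n, R⟩) (fun i => tcode γ (ts i)), fun M SL SU hR hF va vs vr => ?_⟩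
    have h1 : (fun i => (tcode γ (ts i)).realize va) = fun i => (ts i).realize va := by
      funext i
      exact realize_tcode _ (hF.mono (Set.subset_iUnion (fun i => tF (ts i)) i)) va
    simp only [Code.toFml, Eval]
    rw [h1]
    exact hR n R rfl _
  | eq t₁ t₂ =>
    refine ⟨.eq (tcode γ t₁) (tcode γ t₂), fun M SL SU hR hF va vs vr => ?_⟩
    simp only [Code.toFml, Eval]
    rw [realize_tcode t₁ (hF.mono Set.subset_union_left),
      realize_tcode t₂ (hF.mono Set.subset_union_right)]
  | mem X t =>
    refine ⟨.mem X (tcode γ t), fun M SL SU hR hF va vs vr => ?_⟩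
    simp only [Code.toFml, Eval]
    rw [realize_tcode t hF]
  | rmem R t₁ t₂ =>
    refine ⟨.rmem R (tcode γ t₁) (tcode γ t₂), fun M SL SU hR hF va vs vr => ?_⟩
    simp only [Code.toFml, Eval]
    rw [realize_tcode t₁ (hF.mono Set.subset_union_left),
      realize_tcode t₂ (hF.mono Set.subset_union_right)]
  | not φ ih =>
    obtain ⟨c, hc⟩ := ih hok
    refine ⟨.not c, fun M SL SU hR hF va vs vr => ?_⟩
    simp only [Code.toFml, Eval]
    rw [hc M SL SU hR hF]
  | conj ι f ih =>
    have : Finite ι := Cardinal.lt_aleph0_iff_finite.1 hok.1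
    obtain ⟨n, ⟨e⟩⟩ := Finite.exists_equiv_fin ι
    choose c hc using fun i => ih i (hok.2 i)
    refine ⟨.conj n (fun k => c (e.symm k)), fun M SL SU hR hF va vs vr => ?_⟩
    simp only [Code.toFml, Eval]
    rw [← e.symm.forall_congr_right]
    refine forall_congr' fun k => hc _ M SL SU
      (hR.mono (Set.subset_iUnion (fun i => uR (f i)) _))
      (hF.mono (Set.subset_iUnion (fun i => uF (f i)) _)) _ _ _
  | all x φ ih =>
    obtain ⟨c, hc⟩ := ih hok
    refine ⟨.all x c, fun M SL SU hR hF va vs vr => ?_⟩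
    simp only [Code.toFml, Eval]
    exact forall_congr' fun a => hc M SL SU hR hF _ _ _
  | qC X φ ih =>
    obtain ⟨c, hc⟩ := ih hok.2
    refine ⟨.qC X c, fun M SL SU hR hF va vs vr => ?_⟩
    simp only [Code.toFml, Eval]
    exact exists_congr fun a => and_congr_right fun _ => hc M SL SU hR hF _ _ _
  | qWo x y φ ih => exact absurd hok.1 (by simp [Lc])
  | qAA X φ ih => exact absurd hok.1 (by simp [Lc])
  | qII R φ ih => exact absurd hok.1 (by simp [Lc])
  | qCf x y φ ih => exact absurd hok.1 (by simp [Lc])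

theorem exists_U {M : Type} [Nonempty M] (SL : L.Structure M)
    (ρ : (Σ n, L.Relations n) → ℕ) (γ : (Σ n, L.Functions n) → ℕ)
    (A : Set (Σ n, L.Relations n)) (B : Set (Σ n, L.Functions n))
    (hρ : Set.InjOn ρ A) (hγ : Set.InjOn γ B) :
    ∃ SU : U.Structure M, AgreeR SL SU ρ A ∧ AgreeF SL SU γ B := by
  classical
  let SU : U.Structure M :=
    { funMap := fun {n} (k : ℕ) xs =>
        if h : ∃ f : L.Functions n, (⟨n, f⟩ : Σ n, L.Functions n) ∈ B ∧ γ ⟨n, f⟩ = k then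
          SL.funMap h.choose xs else Classical.arbitrary M
      RelMap := fun {n} (k : ℕ) xs =>
        ∃ f : L.Relations n, (⟨n, f⟩ : Σ n, L.Relations n) ∈ A ∧ ρ ⟨n, f⟩ = k ∧
          SL.RelMap f xs }
  refine ⟨SU, ?_, ?_⟩
  · intro n f hf xs
    constructor
    · rintro ⟨g, hg, hgf, hx⟩
      have := hρ hg hf hgf
      simp only [Sigma.mk.injEq, heq_eq_eq, true_and] at this
      rwa [← this]
    · exact fun hx => ⟨f, hf, rfl, hx⟩
  · intro n f hf xs
    have h : ∃ g : L.Functions n, (⟨n, g⟩ : Σ n, L.Functions n) ∈ B ∧ γ ⟨n, g⟩ = γ ⟨n, f⟩ :=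
      ⟨f, hf, rfl⟩
    have h2 : SU.funMap (γ ⟨n, f⟩ : ℕ) xs = SL.funMap h.choose xs := dif_pos h
    rw [h2]
    have := hγ h.choose_spec.1 hf h.choose_spec.2
    simp only [Sigma.mk.injEq, heq_eq_eq, true_and] at this
    rw [this]

theorem exists_L {M : Type} (SU : U.Structure M)
    (ρ : (Σ n, L.Relations n) → ℕ) (γ : (Σ n, L.Functions n) → ℕ)
    (A : Set (Σ n, L.Relations n)) (B : Set (Σ n, L.Functions n)) :
    ∃ SL : L.Structure M, AgreeR SL SU ρ A ∧ AgreeF SL SU γ B :=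
  ⟨{ funMap := fun {n} f xs => SU.funMap (γ ⟨n, f⟩ : ℕ) xs
     RelMap := fun {n} f xs => SU.RelMap (ρ ⟨n, f⟩ : ℕ) xs },
    fun _ _ _ _ => Iff.rfl, fun _ _ _ _ => rfl⟩

theorem hanfVal_le (φ : Fml L) (hok : Ok Lc φ) (hb : BddSpec φ) :
    ∃ c : Code, hanfVal φ ≤ max 1 (hanfVal c.toFml) := by
  obtain ⟨ρ, hρ⟩ := Set.countable_iff_exists_injOn.1 (uR_countable φ hok)
  obtain ⟨γ, hγ⟩ := Set.countable_iff_exists_injOn.1 (uF_countable φ hok)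
  obtain ⟨c, hc⟩ := exists_code ρ γ φ hok
  obtain ⟨κ, hκ⟩ := hb
  refine ⟨c, csSup_le' ?_⟩
  rintro _ ⟨M, SL, hM, rfl⟩
  rcases isEmpty_or_nonempty M with hE | hE
  · simp
  · refine le_max_of_le_right (le_csSup ⟨κ, ?_⟩ ?_)
    · rintro _ ⟨N, SU, hN, rfl⟩
      obtain ⟨SL', h1, h2⟩ := exists_L SU ρ γ (uR φ) (uF φ)
      exact Order.succ_le_of_lt (hκ N SL' fun va vs vr =>
        (hc N SL' SU h1 h2 va vs vr).1 (hN va vs vr))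
    · obtain ⟨SU, h1, h2⟩ := exists_U SL ρ γ (uR φ) (uF φ) hρ hγ
      exact ⟨M, SU, fun va vs vr => (hc M SL SU h1 h2 va vs vr).2 (hM va vs vr), rfl⟩

theorem bddAbove_Lc : BddAbove {c | ∃ (L : FirstOrder.Language.{0,0}) (φ : Fml L),
    IsSentence φ ∧ Ok Lc φ ∧ BddSpec φ ∧ c = hanfVal φ} := by
  obtain ⟨b, hb⟩ := Cardinal.bddAbove_range (fun c : Code => max 1 (hanfVal c.toFml))
  refine ⟨b, ?_⟩
  rintro _ ⟨L, φ, -, hok, hbd, rfl⟩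
  obtain ⟨c, hc⟩ := hanfVal_le φ hok hbd
  exact hc.trans (hb ⟨c, rfl⟩)

end Bounded

/-- The Hanf number of the well-ordering-quantifier logic is at most that of the
countable-set-quantifier logic: `h(L^{wo}_{ω,ω}) ≤ h(L^c_{ω,ω})`. -/
theorem hanf_wo_le_hanf_c : hanfNum Lwo ≤ hanfNum Lc := by
  refine csSup_le_csSup' bddAbove_Lc ?_
  rintro _ ⟨L, φ, ⟨h1, h2, h3⟩, hok, ⟨κ, hκ⟩, rfl⟩
  have hsat : ∀ (M : Type) (S : L.Structure M), @Sat L M S (tr φ) ↔ @Sat L M S φ :=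
    fun M S => sat_tr φ hok h2
  refine ⟨L, tr φ, ⟨?_, sv_tr φ hok h2, rv_tr φ hok h3⟩, ok_tr φ hok,
    ⟨κ, fun M S h => hκ M S ((hsat M S).1 h)⟩, ?_⟩
  · have := fv_tr φ hok
    rw [h1, Set.image_empty] at this
    exact Set.subset_empty_iff.1 this
  · simp only [hanfVal, hsat]

end Hanf
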